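/- There are no complete stable positive solutions of Δu = 1/u on all of ℝⁿ for 2 ≤ n ≤ 6. -/

import Mathlib

open MeasureTheory Real

noncomputable def laplacian {n : ℕ} (u : EuclideanSpace ℝ (Fin n) → ℝ)
    (x : EuclideanSpace ℝ (Fin n)) : ℝ :=
  ∑ i, fderiv ℝ (fun y => fderiv ℝ u y (EuclideanSpace.single i 1)) x
    (EuclideanSpace.single i 1)

theorem norm_gradient_sq {n : ℕ} (ζ : EuclideanSpace ℝ (Fin n) → ℝ)
    (x : EuclideanSpace ℝ (Fin n)) :
    ‖gradient ζ x‖ ^ 2 = ∑ i, (fderiv ℝ ζ x (EuclideanSpace.single i 1)) ^ 2 := by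
  rw [← (EuclideanSpace.basisFun (Fin n) ℝ).sum_sq_inner_left]
  simp [gradient, InnerProductSpace.toDual_symm_apply]

/-- Green's identity against a compactly supported test function. -/
theorem integral_mul_laplacian {n : ℕ} {f u : EuclideanSpace ℝ (Fin n) → ℝ}
    (hf : ContDiff ℝ 1 f) (hfc : HasCompactSupport f) (hu : ContDiff ℝ 2 u) :
    ∫ x, f x * laplacian u x = -∫ x, ∑ i, fderiv ℝ f x (EuclideanSpace.single i 1) *
      fderiv ℝ u x (EuclideanSpace.single i 1) := by
  have hg (i : Fin n) : ContDiff ℝ 1 fun y => fderiv ℝ u y (EuclideanSpace.single i 1) :=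
    (hu.fderiv_right (m := 1) (by norm_num)).clm_apply contDiff_const
  have hf' (i : Fin n) : Continuous fun y => fderiv ℝ f y (EuclideanSpace.single i 1) :=
    (hf.continuous_fderiv one_ne_zero).clm_apply continuous_const
  have hg' (i : Fin n) : Continuous fun x =>
      fderiv ℝ (fun y => fderiv ℝ u y (EuclideanSpace.single i 1)) x
        (EuclideanSpace.single i 1) :=
    ((hg i).continuous_fderiv one_ne_zero).clm_apply continuous_const
  have int₁ (i : Fin n) : Integrable fun x => fderiv ℝ f x (EuclideanSpace.single i 1) *
      fderiv ℝ u x (EuclideanSpace.single i 1) :=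
    ((hf' i).mul (hg i).continuous).integrable_of_hasCompactSupport
      ((hfc.fderiv_apply (𝕜 := ℝ) _).mul_right)
  have int₂ (i : Fin n) : Integrable fun x => f x *
      fderiv ℝ (fun y => fderiv ℝ u y (EuclideanSpace.single i 1)) x
        (EuclideanSpace.single i 1) :=
    (hf.continuous.mul (hg' i)).integrable_of_hasCompactSupport hfc.mul_right
  simp only [laplacian, Finset.mul_sum]
  rw [integral_finsetSum _ fun i _ => int₂ i, integral_finsetSum _ fun i _ => int₁ i,
    ← Finset.sum_neg_distrib]
  refine Finset.sum_congr rfl fun i _ => ?_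
  exact integral_mul_fderiv_eq_neg_fderiv_mul_of_integrable (int₁ i) (int₂ i)
    ((hf.continuous.mul (hg i).continuous).integrable_of_hasCompactSupport hfc.mul_right)
    (fun x _ => hf.differentiable one_ne_zero x)
    (fun x _ => (hg i).differentiable one_ne_zero x)

/-- The case `q = 9 / 4` of the integral estimate
`∫ u ^ (-2 q - 2) η ² ≤ C ∫ u ^ (-2 q) |∇η| ²`, valid for `q ^ 2 < 2 q + 1`. -/
theorem integral_rpow_mul_sq_le_of_stable {n : ℕ} {u η : EuclideanSpace ℝ (Fin n) → ℝ}
    (hu : ContDiff ℝ 2 u) (hpos : ∀ x, 0 < u x) (heq : ∀ x, laplacian u x = 1 / u x)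
    (hstable : ∀ ζ : EuclideanSpace ℝ (Fin n) → ℝ, ContDiff ℝ 1 ζ → HasCompactSupport ζ →
      ∫ x, (ζ x) ^ 2 / (u x) ^ 2 ≤ ∫ x, ‖gradient ζ x‖ ^ 2)
    (hη : ContDiff ℝ 1 η) (hηc : HasCompactSupport η) :
    ∫ x, (u x ^ (-1 / 4 : ℝ)) ^ 26 * η x ^ 2 ≤
      225 * ∫ x, ∑ i, ((u x ^ (-1 / 4 : ℝ)) ^ 9 *
        fderiv ℝ η x (EuclideanSpace.single i 1)) ^ 2 := by
  set t : EuclideanSpace ℝ (Fin n) → ℝ := fun x => u x ^ (-1 / 4 : ℝ) with ht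
  have ht1 : ContDiff ℝ 1 t :=
    (hu.of_le (by norm_num)).rpow_const_of_ne fun x => (hpos x).ne'
  have ht4 (x) : t x ^ 4 = 1 / u x := by
    rw [ht]
    dsimp only
    rw [← rpow_mul_natCast (hpos x).le]
    norm_num [rpow_neg_one]
  have htd (x) : HasFDerivAt t ((-1 / 4 * t x ^ 5) • fderiv ℝ u x) x := by
    have h := (hu.differentiable two_ne_zero x).hasFDerivAt.rpow_const (p := -1 / 4)
      (Or.inl (hpos x).ne')
    have h5 : t x ^ 5 = u x ^ (-1 / 4 - 1 : ℝ) := by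
      rw [ht]
      dsimp only
      rw [← rpow_mul_natCast (hpos x).le]
      norm_num
    rwa [← h5] at h
  have hηd (x) := (hη.differentiable one_ne_zero x).hasFDerivAt
  set D : Fin n → EuclideanSpace ℝ (Fin n) → ℝ :=
    fun i x => fderiv ℝ u x (EuclideanSpace.single i 1)
  set E : Fin n → EuclideanSpace ℝ (Fin n) → ℝ :=
    fun i x => fderiv ℝ η x (EuclideanSpace.single i 1)
  have hDc (i) : Continuous (D i) :=
    (hu.continuous_fderiv two_ne_zero).clm_apply continuous_const
  have hEc (i) : Continuous (E i) :=
    (hη.continuous_fderiv one_ne_zero).clm_apply continuous_const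
  have hEs (i) : HasCompactSupport (E i) := hηc.fderiv_apply (𝕜 := ℝ) _
  have htc := ht1.continuous
  have hηcont := hη.continuous
  let Q : Fin n → EuclideanSpace ℝ (Fin n) → ℝ := fun i x => t x ^ 13 * D i x * η x
  let W : Fin n → EuclideanSpace ℝ (Fin n) → ℝ := fun i x => t x ^ 9 * E i x
  have hQc (i) : Continuous (Q i) := by fun_prop
  have hWc (i) : Continuous (W i) := by fun_prop
  have hQs (i) : HasCompactSupport (Q i) := hηc.mul_left
  have hWs (i) : HasCompactSupport (W i) := (hEs i).mul_left
  have intQ (i) : Integrable fun x => Q i x ^ 2 := by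
    simp only [sq]
    exact ((hQc i).mul (hQc i)).integrable_of_hasCompactSupport (hQs i).mul_left
  have intW (i) : Integrable fun x => W i x ^ 2 := by
    simp only [sq]
    exact ((hWc i).mul (hWc i)).integrable_of_hasCompactSupport (hWs i).mul_left
  have intQW (i) : Integrable fun x => Q i x * W i x :=
    ((hQc i).mul (hWc i)).integrable_of_hasCompactSupport (hWs i).mul_left
  -- Green's identity tested with `u ^ (-11 / 2) η ²`
  have hgreen : ∫ x, t x ^ 26 * η x ^ 2 =
      ∫ x, ∑ i, (11 / 2 * Q i x ^ 2 - 2 * (Q i x * W i x)) := by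
    have h := integral_mul_laplacian (f := fun x => t x ^ 22 * η x ^ 2) (u := u)
      ((ht1.pow 22).mul (hη.pow 2)) (by
        simp only [sq]
        exact (hηc.mul_left (f := η)).mul_left) hu
    rw [← integral_neg] at h
    refine Eq.trans (integral_congr_ae (.of_forall fun x => ?_))
      (h.trans (integral_congr_ae (.of_forall fun x => ?_)))
    · simp only [heq, ← ht4]
      ring
    · simp only [← Finset.sum_neg_distrib]
      refine Finset.sum_congr rfl fun i _ => ?_
      rw [show fderiv ℝ (fun x => t x ^ 22 * η x ^ 2) x = _ from
        (((htd x).pow 22).mul ((hηd x).pow 2)).fderiv]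
      simp [Q, W, D, E]
      ring
  -- stability tested with `u ^ (-9 / 4) η`
  have hstab : ∫ x, t x ^ 26 * η x ^ 2 ≤ ∫ x, ∑ i, (-(9 / 4) * Q i x + W i x) ^ 2 := by
    have h := hstable (fun x => t x ^ 9 * η x) ((ht1.pow 9).mul hη) hηc.mul_left
    refine Eq.trans_le (integral_congr_ae (.of_forall fun x => ?_))
      (h.trans_eq (integral_congr_ae (.of_forall fun x => ?_)))
    · have : ((u x) ^ 2)⁻¹ = t x ^ 8 := by
        rw [show t x ^ 8 = (t x ^ 4) ^ 2 by ring, ht4]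
        simp
      simp only [div_eq_mul_inv, this]
      ring
    · simp only [norm_gradient_sq]
      refine Finset.sum_congr rfl fun i _ => ?_
      rw [show fderiv ℝ (fun x => t x ^ 9 * η x) x = _ from (((htd x).pow 9).mul (hηd x)).fderiv]
      simp [Q, W, D, E]
      ring
  have intS : Integrable fun x => ∑ i, (11 / 2 * Q i x ^ 2 - 2 * (Q i x * W i x)) :=
    integrable_finsetSum _ fun i _ => ((intQ i).const_mul _).sub ((intQW i).const_mul _)
  have intSW : Integrable fun x => ∑ i, W i x ^ 2 := integrable_finsetSum _ fun i _ => intW i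
  have hcomb : ∫ x, ∑ i, (-(9 / 4) * Q i x + W i x) ^ 2 ≤
      ∫ x, (24 / 25 * ∑ i, (11 / 2 * Q i x ^ 2 - 2 * (Q i x * W i x)) +
        9 * ∑ i, W i x ^ 2) := by
    refine integral_mono ?_ ?_ fun x => ?_
    · refine integrable_finsetSum _ fun i _ => ?_
      refine ((((intQ i).const_mul (81 / 16)).sub ((intQW i).const_mul (9 / 2))).add
        (intW i)).congr (.of_forall fun x => ?_)
      simp only [Pi.add_apply, Pi.sub_apply]
      ring
    · exact (intS.const_mul _).add (intSW.const_mul _)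
    · simp only [Finset.mul_sum, ← Finset.sum_add_distrib]
      refine Finset.sum_le_sum fun i _ => ?_
      nlinarith [sq_nonneg (Q i x + 6 * W i x), sq_nonneg (W i x)]
  rw [integral_add (intS.const_mul _) (intSW.const_mul _), integral_const_mul, integral_const_mul, ← hgreen] at hcomb
  change ∫ x, t x ^ 26 * η x ^ 2 ≤ 225 * ∫ x, ∑ i, W i x ^ 2
  linarith

theorem exists_pow_le_mul_pow_add {ε : ℝ} (hε : 0 < ε) :
    ∃ C, ∀ z : ℝ, 0 ≤ z → z ^ 18 ≤ ε * z ^ 26 + C := by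
  refine ⟨(1 / ε + 1) ^ 18, fun z hz => ?_⟩
  rcases le_total (1 / ε + 1) z with h | h
  · have h1 : 1 ≤ z := le_trans (by have : 0 < 1 / ε := by positivity
                                    linarith) h
    have h2 : 1 ≤ ε * z ^ 8 := by
      have h3 : z ≤ z ^ 8 := le_self_pow₀ h1 (by norm_num)
      have h4 : ε * (1 / ε) = 1 := by field_simp
      nlinarith
    have h5 : z ^ 18 * 1 ≤ z ^ 18 * (ε * z ^ 8) := by gcongr
    have : 0 ≤ (1 / ε + 1) ^ 18 := by positivity
    linarith
  · have : z ^ 18 ≤ (1 / ε + 1) ^ 18 := by gcongr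
    have : 0 ≤ ε * z ^ 26 := by positivity
    linarith

/-- Decay of the cutoff integrals of `u ^ (-13 / 2)` on balls of radius `r ^ 4`. -/
theorem exists_integral_rpow_mul_cutoff_le {n : ℕ} {u φ : EuclideanSpace ℝ (Fin n) → ℝ}
    (hu : ContDiff ℝ 2 u) (hpos : ∀ x, 0 < u x) (heq : ∀ x, laplacian u x = 1 / u x)
    (hstable : ∀ ζ : EuclideanSpace ℝ (Fin n) → ℝ, ContDiff ℝ 1 ζ → HasCompactSupport ζ →
      ∫ x, (ζ x) ^ 2 / (u x) ^ 2 ≤ ∫ x, ‖gradient ζ x‖ ^ 2)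
    (hφ1 : ContDiff ℝ 1 φ) (hφs : HasCompactSupport φ) (hφ0 : ∀ x, 0 ≤ φ x)
    (hφle : ∀ x, φ x ≤ 1) :
    ∃ K, ∀ r : ℝ, 0 < r →
      ∫ x, (u x ^ (-1 / 4 : ℝ)) ^ 26 * φ ((r ^ 4)⁻¹ • x) ^ 26 ≤ K * ((r ^ 4) ^ n / r ^ 26) := by
  set t : EuclideanSpace ℝ (Fin n) → ℝ := fun x => u x ^ (-1 / 4 : ℝ) with ht
  have htc : Continuous t := hu.continuous.rpow_const fun x => Or.inl (hpos x).ne'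
  have htpos (x) : 0 < t x := rpow_pos_of_pos (hpos x) _
  set g : EuclideanSpace ℝ (Fin n) → ℝ :=
    fun x => ∑ i, (fderiv ℝ φ x (EuclideanSpace.single i 1)) ^ 2 with hg
  have hgc : Continuous g := continuous_finsetSum _ fun i _ =>
    ((hφ1.continuous_fderiv one_ne_zero).clm_apply continuous_const).pow 2
  have hgs : HasCompactSupport g :=
    (hφs.fderiv (𝕜 := ℝ)).mono fun x hx h0 => hx (by simp [hg, h0])
  have hg0 (x) : 0 ≤ g x := Finset.sum_nonneg fun i _ => sq_nonneg _
  obtain ⟨G, hG⟩ := hgc.bounded_above_of_compact_support hgs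
  have hG0 : 0 ≤ G := (norm_nonneg _).trans (hG 0)
  obtain ⟨C, hC⟩ := exists_pow_le_mul_pow_add (ε := 1 / (2 * (225 * 169) * (G + 1)))
    (by positivity)
  refine ⟨2 * (225 * 169) * C * ∫ x, g x, fun r hr0 => ?_⟩
  have hR0 : 0 < r ^ 4 := by positivity
  set ψ : EuclideanSpace ℝ (Fin n) → ℝ := fun x => φ ((r ^ 4)⁻¹ • x)
  have hψ0 (x) : 0 ≤ ψ x := hφ0 _
  have hψ1 (x) : ψ x ≤ 1 := hφle _
  have hψd : ContDiff ℝ 1 ψ := hφ1.comp (contDiff_const_smul _)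
  have hψc := hψd.continuous
  have hψs : HasCompactSupport ψ := hφs.comp_smul (inv_ne_zero hR0.ne')
  have hgRs : HasCompactSupport fun x => g ((r ^ 4)⁻¹ • x) :=
    hgs.comp_smul (inv_ne_zero hR0.ne')
  have hψs' (k : ℕ) (hk : k ≠ 0) : HasCompactSupport fun x => ψ x ^ k :=
    hψs.comp_left (g := fun y => y ^ k) (by simp [hk])
  have h := integral_rpow_mul_sq_le_of_stable hu hpos heq hstable (hψd.pow 13)
    (hψs' 13 (by norm_num))
  have hgrad (x) : ∑ i, (t x ^ 9 * fderiv ℝ (fun y => ψ y ^ 13) x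
      (EuclideanSpace.single i 1)) ^ 2 =
      169 * t x ^ 18 * ψ x ^ 24 * (r ^ 8)⁻¹ * g ((r ^ 4)⁻¹ • x) := by
    simp only [hg, Finset.mul_sum]
    refine Finset.sum_congr rfl fun i _ => ?_
    have hd : fderiv ℝ ψ x = (r ^ 4)⁻¹ • fderiv ℝ φ ((r ^ 4)⁻¹ • x) :=
      fderiv_comp_smul (f := φ) (x := x) (r ^ 4)⁻¹
    rw [((hψd.differentiable one_ne_zero x).hasFDerivAt.pow 13).fderiv, hd]
    simp
    ring
  have hyoung (x) : 169 * t x ^ 18 * ψ x ^ 24 * (r ^ 8)⁻¹ * g ((r ^ 4)⁻¹ • x) ≤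
      1 / (2 * 225) * (t x ^ 26 * ψ x ^ 26) +
        169 * C * (r ^ 26)⁻¹ * g ((r ^ 4)⁻¹ • x) := by
    set γ := g ((r ^ 4)⁻¹ • x)
    have hγ0 : 0 ≤ γ := hg0 _
    have hγG : γ ≤ G := (le_abs_self _).trans (hG _)
    have hy := hC (t x * ψ x * r) (mul_nonneg (mul_nonneg (htpos x).le (hψ0 x)) hr0.le)
    have hy0 : 0 ≤ t x * ψ x := mul_nonneg (htpos x).le (hψ0 x)
    have e1 : t x ^ 18 * ψ x ^ 24 ≤ (t x * ψ x) ^ 18 := by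
      rw [mul_pow]
      exact mul_le_mul_of_nonneg_left
        (pow_le_pow_of_le_one (hψ0 x) (hψ1 x) (by norm_num)) (pow_nonneg (htpos x).le _)
    have e2 : γ * (1 / (2 * (225 * 169) * (G + 1))) ≤ 1 / (2 * (225 * 169)) := by
      rw [mul_one_div, div_le_div_iff₀ (by positivity) (by positivity)]
      nlinarith
    calc 169 * t x ^ 18 * ψ x ^ 24 * (r ^ 8)⁻¹ * γ
        = 169 * (r ^ 8)⁻¹ * γ * (t x ^ 18 * ψ x ^ 24) := by ring
      _ ≤ 169 * (r ^ 8)⁻¹ * γ * (t x * ψ x) ^ 18 := by gcongr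
      _ = 169 * (r ^ 26)⁻¹ * γ * (t x * ψ x * r) ^ 18 := by
        field_simp
      _ ≤ 169 * (r ^ 26)⁻¹ * γ * (1 / (2 * (225 * 169) * (G + 1)) *
            (t x * ψ x * r) ^ 26 + C) := by gcongr
      _ = 169 * (t x * ψ x) ^ 26 * (γ * (1 / (2 * (225 * 169) * (G + 1)))) +
            169 * C * (r ^ 26)⁻¹ * γ := by
        field_simp
      _ ≤ 169 * (t x * ψ x) ^ 26 * (1 / (2 * (225 * 169))) +
            169 * C * (r ^ 26)⁻¹ * γ := by gcongr
      _ = _ := by ring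
  have intA : Integrable fun x => t x ^ 26 * ψ x ^ 26 :=
    ((htc.pow 26).mul (hψc.pow 26)).integrable_of_hasCompactSupport
      (hψs' 26 (by norm_num)).mul_left
  have hgRc : Continuous fun x => g ((r ^ 4)⁻¹ • x) := hgc.comp (continuous_const_smul _)
  have intB : Integrable fun x => g ((r ^ 4)⁻¹ • x) :=
    hgRc.integrable_of_hasCompactSupport hgRs
  have intL : Integrable fun x =>
      169 * t x ^ 18 * ψ x ^ 24 * (r ^ 8)⁻¹ * g ((r ^ 4)⁻¹ • x) :=
    Continuous.integrable_of_hasCompactSupport (by fun_prop) hgRs.mul_left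
  have hmono := integral_mono intL
    ((intA.const_mul (1 / (2 * 225))).add (intB.const_mul (169 * C * (r ^ 26)⁻¹))) hyoung
  simp only [Pi.add_apply] at hmono
  rw [integral_add (intA.const_mul _) (intB.const_mul _), integral_const_mul,
    integral_const_mul, Measure.integral_comp_inv_smul_of_nonneg _ _ hR0.le] at hmono
  simp only [finrank_euclideanSpace, Fintype.card_fin, smul_eq_mul] at hmono
  simp only [← pow_mul, show 13 * 2 = 26 from rfl] at h
  change ∫ x, t x ^ 26 * ψ x ^ 26 ≤ 225 * ∫ x, ∑ i, (t x ^ 9 * fderiv ℝ (fun y => ψ y ^ 13) x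
      (EuclideanSpace.single i 1)) ^ 2 at h
  simp only [hgrad] at h
  change ∫ x, t x ^ 26 * ψ x ^ 26 ≤ _
  have : 2 * (225 * 169) * C * (∫ x, g x) * ((r ^ 4) ^ n / r ^ 26) =
    450 * (169 * C * (r ^ 26)⁻¹ * ((r ^ 4) ^ n * ∫ x, g x)) := by ring
  linarith

/-- There are no entire stable positive solutions of `Δu = 1/u` on `ℝⁿ` for
`2 ≤ n ≤ 6`. -/
theorem stmt15 (n : ℕ) (hn2 : 2 ≤ n) (hn6 : n ≤ 6)
    (u : EuclideanSpace ℝ (Fin n) → ℝ) (hsmooth : ContDiff ℝ (⊤ : ℕ∞) u)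
    (hpos : ∀ x, 0 < u x) (heq : ∀ x, laplacian u x = 1 / u x) :
    ¬ (∀ ζ : EuclideanSpace ℝ (Fin n) → ℝ, ContDiff ℝ 1 ζ → HasCompactSupport ζ →
        ∫ x, (ζ x) ^ 2 / (u x) ^ 2 ≤ ∫ x, ‖gradient ζ x‖ ^ 2) := by
  intro hstable
  have hu : ContDiff ℝ 2 u := contDiff_infty.1 hsmooth 2
  set t : EuclideanSpace ℝ (Fin n) → ℝ := fun x => u x ^ (-1 / 4 : ℝ) with ht
  have ht1 : ContDiff ℝ 1 t :=
    (hu.of_le (by norm_num)).rpow_const_of_ne fun x => (hpos x).ne'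
  have htc := ht1.continuous
  have htpos (x) : 0 < t x := rpow_pos_of_pos (hpos x) _
  let φ : ContDiffBump (0 : EuclideanSpace ℝ (Fin n)) := ⟨1, 2, one_pos, one_lt_two⟩
  have hφ1 : ContDiff ℝ 1 φ := φ.contDiff
  have hφs : HasCompactSupport φ := φ.hasCompactSupport
  have hφc := hφ1.continuous
  obtain ⟨K, hφR⟩ := exists_integral_rpow_mul_cutoff_le hu hpos heq hstable hφ1 hφs
    (fun _ => φ.nonneg) (fun _ => φ.le_one)
  set J := ∫ x, t x ^ 26 * φ x ^ 26
  have intJ : Continuous fun x => t x ^ 26 * φ x ^ 26 := (htc.pow 26).mul (hφc.pow 26)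
  have hφs' : HasCompactSupport fun x => φ x ^ 26 :=
    hφs.comp_left (g := fun y => y ^ 26) (by simp)
  have hJpos : 0 < J := by
    refine intJ.integral_pos_of_hasCompactSupport_nonneg_nonzero (x := 0) hφs'.mul_left
      (fun x => mul_nonneg (pow_nonneg (htpos x).le _) (pow_nonneg φ.nonneg _)) ?_
    have h0 : φ 0 = 1 := φ.one_of_mem_closedBall (by simp [φ])
    simp [h0, (htpos 0).ne']
  have hJle (r : ℝ) (hr : 2 ≤ r) : J ≤ ∫ x, t x ^ 26 * φ ((r ^ 4)⁻¹ • x) ^ 26 := by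
    have hR0 : 0 < r ^ 4 := by positivity
    have hR2 : 2 ≤ r ^ 4 := hr.trans (le_self_pow₀ (by linarith) (by norm_num))
    refine integral_mono (intJ.integrable_of_hasCompactSupport hφs'.mul_left)
      (((htc.pow 26).mul ((hφc.comp (continuous_const_smul _)).pow 26)).integrable_of_hasCompactSupport
        (HasCompactSupport.mul_left (hφs'.comp_smul (inv_ne_zero hR0.ne')))) fun x => ?_
    refine mul_le_mul_of_nonneg_left (pow_le_pow_left₀ φ.nonneg ?_ _)
      (pow_nonneg (htpos x).le _)
    rcases le_total 2 ‖x‖ with hx | hx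
    · rw [φ.zero_of_le_dist (by simpa [φ] using hx)]
      exact φ.nonneg
    · rw [φ.one_of_mem_closedBall (x := (r ^ 4)⁻¹ • x)]
      · exact φ.le_one
      · rw [mem_closedBall_zero_iff, norm_smul, norm_inv, norm_of_nonneg hR0.le]
        change _ ≤ (1 : ℝ)
        rw [inv_mul_le_iff₀ hR0]
        linarith
  have hbound (r : ℝ) (hr : 2 ≤ r) : J * r ^ 2 ≤ K := by
    have hr0 : 0 < r := by linarith
    have h := (hJle r hr).trans (hφR r hr0)
    have hKp : 0 < K := by
      have : 0 < (r ^ 4) ^ n / r ^ 26 := by positivity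
      exact pos_of_mul_pos_left (hJpos.trans_le h) this.le
    have hp : (r ^ 4) ^ n ≤ r ^ 24 := by
      rw [← pow_mul]
      exact pow_le_pow_right₀ (by linarith) (by omega)
    calc J * r ^ 2 ≤ K * (r ^ 24 / r ^ 26) * r ^ 2 := by
          gcongr
          exact h.trans (by gcongr)
      _ = K := by field_simp
  have h1 := hbound (2 + |K| / J) (by
    have : 0 ≤ |K| / J := by positivity
    linarith)
  have h2 : J * (|K| / J) = |K| := by field_simp
  have h3 : 0 ≤ |K| / J := by positivity
  nlinarith [le_abs_self K, abs_nonneg K]
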